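/- Let N be a positive natural number, v ∈ EuclideanSpace ℝ (Fin N), and α, α₀ > 0. Define E : EuclideanSpace ℝ (Fin N) → ℝ by E(ψ) = α₀ ‖ψ − v‖² + α · (0 if ψ = 0, 1 otherwise). If ‖v‖² > α/α₀ then ψ = v is the unique global minimizer of E; if ‖v‖² < α/α₀ then ψ = 0 is the unique global minimizer of E. -/

import Mathlib

open scoped Classical

/-- Group hard-thresholding solves the vector-valued L0-regularized proximal
subproblem. -/
theorem group_hard_threshold_minimizer (N : ℕ) (hN : 0 < N)
    (v : EuclideanSpace ℝ (Fin N)) (α α₀ : ℝ) (hα : 0 < α) (hα₀ : 0 < α₀)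
    (E : EuclideanSpace ℝ (Fin N) → ℝ)
    (hE : ∀ ψ : EuclideanSpace ℝ (Fin N),
      E ψ = α₀ * ‖ψ - v‖ ^ 2 + α * (if ψ = 0 then 0 else 1)) :
    (‖v‖ ^ 2 > α / α₀ → ∀ ψ : EuclideanSpace ℝ (Fin N), ψ ≠ v → E v < E ψ) ∧
      (‖v‖ ^ 2 < α / α₀ → ∀ ψ : EuclideanSpace ℝ (Fin N), ψ ≠ 0 → E 0 < E ψ) := by
  refine ⟨fun h ψ hψ => ?_, fun h ψ hψ => ?_⟩
  · rw [gt_iff_lt, div_lt_iff₀' hα₀] at h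
    have hv : v ≠ 0 := by
      rintro rfl
      simp only [norm_zero] at h
      linarith
    rw [hE v, hE ψ, if_neg hv, sub_self, norm_zero]
    by_cases h0 : ψ = 0
    · rw [if_pos h0, h0, zero_sub, norm_neg]
      linarith
    · rw [if_neg h0]
      have : 0 < ‖ψ - v‖ := norm_pos_iff.mpr (sub_ne_zero.mpr hψ)
      have : 0 < α₀ * ‖ψ - v‖ ^ 2 := by positivity
      linarith
  · rw [lt_div_iff₀' hα₀] at h
    rw [hE 0, hE ψ, if_pos rfl, if_neg hψ, zero_sub, norm_neg]
    have : 0 ≤ α₀ * ‖ψ - v‖ ^ 2 := by positivity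
    linarith
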